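/- arXiv:1610.09731 — 2 statements merged into one kernel-verified Lean document; each statement's English description precedes it below -/
import Mathlib

section
/- For every nonnegative integer M and every x > 0, K₀(x) ≥ −(ln(x/2) + γ) − Σ_{n=1}^{M} (1/(n!)²)(x²/4)ⁿ (ln(x/2) + γ − hₙ). -/
noncomputable section

/-- The `n`-th harmonic number `1 + 1/2 + ⋯ + 1/n` as a real number. -/
def harmonicNum (n : ℕ) : ℝ := ∑ i ∈ Finset.range n, (1 : ℝ) / (i + 1)

/-- The modified Bessel function of the first kind of order zero, via its power series. -/
def besselI0 (x : ℝ) : ℝ := ∑' n : ℕ, (1 / ((n.factorial : ℝ))^2) * (x^2 / 4)^n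

/-- The auxiliary series `Ψ(x) = Σ_{n≥1} hₙ/(n!)² (x²/4)ⁿ`. -/
def besselPsi (x : ℝ) : ℝ :=
  ∑' n : ℕ, (harmonicNum (n + 1) / (((n + 1).factorial : ℝ))^2) * (x^2 / 4)^(n + 1)

/-- The modified Bessel function of the second kind of order zero:
`K₀(x) = −(ln(x/2) + γ) I₀(x) + Ψ(x)`. -/
def besselK0 (x : ℝ) : ℝ :=
  -(Real.log (x / 2) + Real.eulerMascheroniConstant) * besselI0 x + besselPsi x

namespace BK

/-- power series -/
def P (c : ℕ → ℝ) (t : ℝ) : ℝ := ∑' n : ℕ, c n * t ^ n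

/-- everywhere summable -/
def E (c : ℕ → ℝ) : Prop := ∀ r : ℝ, Summable (fun n => c n * r ^ n)

/-- Euler operator on coefficients -/
def T (c : ℕ → ℝ) : ℕ → ℝ := fun n => n * c n

lemma E_T {c : ℕ → ℝ} (h : E c) : E (T c) := by
  intro r
  refine Summable.of_norm_bounded (h (2 * r)).abs ?_
  intro n
  have h2 : (n : ℝ) ≤ 2 ^ n := by exact_mod_cast (Nat.lt_two_pow_self (n := n)).le
  rw [Real.norm_eq_abs, T, abs_mul, abs_mul, abs_mul, mul_pow, abs_mul (2 ^ n),
    abs_of_nonneg (by positivity : (0 : ℝ) ≤ n), abs_of_nonneg (by positivity : (0 : ℝ) ≤ 2 ^ n)]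
  have := mul_le_mul_of_nonneg_right h2 (by positivity : 0 ≤ |c n| * |r ^ n|)
  linarith

lemma P_deriv' {c : ℕ → ℝ} (h : E c) (t : ℝ) :
    HasDerivAt (P c) (∑' n : ℕ, c n * (n * t ^ (n - 1))) t := by
  set R : ℝ := |t| + 1 with hR
  have hR1 : 1 ≤ R := by have := abs_nonneg t; linarith
  refine hasDerivAt_tsum_of_isPreconnected (t := Metric.ball (0 : ℝ) R)
    (u := fun n => |T c n * R ^ n|) (g := fun n y => c n * y ^ n)
    (g' := fun n y => c n * (n * y ^ (n - 1))) (y₀ := 0)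
    ((E_T h) R).abs Metric.isOpen_ball (convex_ball 0 R).isPreconnected ?_ ?_ ?_ (h 0) ?_
  · intro n y _
    exact (hasDerivAt_pow n y).const_mul (c n)
  · intro n y hy
    have hy' : |y| ≤ R := by
      rw [Metric.mem_ball, dist_zero_right, Real.norm_eq_abs] at hy
      exact hy.le
    rw [Real.norm_eq_abs, T, abs_mul, abs_mul, abs_mul, abs_mul, abs_pow, abs_pow,
      abs_of_nonneg (by linarith : 0 ≤ R)]
    have h1 : |y| ^ (n - 1) ≤ R ^ n :=
      (pow_le_pow_left₀ (abs_nonneg y) hy' _).trans (pow_le_pow_right₀ hR1 (by omega))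
    have := mul_le_mul_of_nonneg_left h1 (by positivity : 0 ≤ |c n| * |(n : ℝ)|)
    linarith
  · simp; linarith
  · simp [hR]

lemma P_deriv {c : ℕ → ℝ} (h : E c) {t : ℝ} (ht : t ≠ 0) :
    HasDerivAt (P c) (P (T c) t / t) t := by
  convert P_deriv' h t using 1
  rw [P, ← tsum_div_const]
  congr 1
  ext n
  rcases n with _ | n
  · simp [T]
  · simp only [T, Nat.add_sub_cancel, pow_succ]
    field_simp

lemma P_cont {c : ℕ → ℝ} (h : E c) : Continuous (P c) :=
  continuous_iff_continuousAt.2 fun t => (P_deriv' h t).continuousAt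

lemma P_zero (c : ℕ → ℝ) : P c 0 = c 0 := by
  rw [P, tsum_eq_single 0]
  · simp
  · intro n hn; simp [hn]

/-- coefficients of `I₀` -/
def a (n : ℕ) : ℝ := 1 / ((n.factorial : ℝ)) ^ 2
/-- coefficients of `Ψ` -/
def b (n : ℕ) : ℝ := harmonicNum n / ((n.factorial : ℝ)) ^ 2

lemma a_pos (n : ℕ) : 0 < a n := by unfold a; positivity

lemma a_succ (n : ℕ) : a (n + 1) = a n / ((n : ℝ) + 1) ^ 2 := by
  unfold a
  rw [Nat.factorial_succ]; push_cast
  have : (n.factorial : ℝ) ≠ 0 := by positivity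
  field_simp

lemma b_eq (n : ℕ) : b n = harmonicNum n * a n := by unfold a b; ring

lemma h_succ (n : ℕ) : harmonicNum (n + 1) = harmonicNum n + 1 / ((n : ℝ) + 1) := by
  simp [harmonicNum, Finset.sum_range_succ]

lemma h_nonneg (n : ℕ) : 0 ≤ harmonicNum n := by
  unfold harmonicNum; positivity

lemma h_mono : Monotone harmonicNum := by
  refine monotone_nat_of_le_succ fun n => ?_
  rw [h_succ]
  have : 0 ≤ 1 / ((n : ℝ) + 1) := by positivity
  linarith

lemma h_le (n : ℕ) : harmonicNum n ≤ n := by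
  induction n with
  | zero => simp [harmonicNum]
  | succ n ih =>
    rw [h_succ]; push_cast
    have : 1 / ((n : ℝ) + 1) ≤ 1 := by
      rw [div_le_one (by positivity)]
      have : (0 : ℝ) ≤ n := by positivity
      linarith
    linarith

lemma E_a : E a := by
  intro r
  refine Summable.of_norm_bounded (Real.summable_pow_div_factorial r).abs ?_
  intro n
  have h1 : (1 : ℝ) ≤ n.factorial := by exact_mod_cast Nat.one_le_iff_ne_zero.2 n.factorial_ne_zero
  rw [Real.norm_eq_abs, a, one_div_mul_eq_div, abs_div, abs_div,
    abs_of_nonneg (by positivity : (0 : ℝ) ≤ n.factorial),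
    abs_of_nonneg (by positivity : (0 : ℝ) ≤ (n.factorial : ℝ) ^ 2)]
  gcongr
  nlinarith

lemma E_b : E b := by
  intro r
  refine Summable.of_norm_bounded ((E_T E_a) r).abs ?_
  intro n
  rw [Real.norm_eq_abs, abs_mul, abs_mul, b_eq, T, abs_mul, abs_mul,
    abs_of_nonneg (h_nonneg n), abs_of_nonneg (by positivity : (0 : ℝ) ≤ n)]
  gcongr
  exact h_le n

lemma P_TTa (t : ℝ) : P (T (T a)) t = t * P a t := by
  rw [P, (E_T (E_T E_a) t).tsum_eq_zero_add, P, ← tsum_mul_left]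
  simp only [T, a_succ]
  simp only [Nat.cast_zero, zero_mul, zero_add]
  congr 1; ext n
  push_cast
  field_simp
  ring

lemma P_TTb (t : ℝ) : P (T (T b)) t = t * P b t + P (T a) t := by
  rw [P, (E_T (E_T E_b) t).tsum_eq_zero_add, P, ← tsum_mul_left, P, (E_T E_a t).tsum_eq_zero_add]
  have e0 : T a 0 = 0 := by simp [T]
  have e1 : T (T b) 0 = 0 := by simp [T]
  rw [e0, e1, zero_mul, zero_add, zero_add, ← Summable.tsum_add ((E_b t).mul_left t)
    (((summable_nat_add_iff 1).2 (E_T E_a t)))]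
  congr 1; ext n
  simp only [T]
  simp only [b_eq, h_succ, a_succ]
  push_cast
  field_simp
  ring

lemma F_ge {t : ℝ} (ht : 0 ≤ t) : 0 < P a t := by
  refine (E_a t).tsum_pos (fun n => ?_) 0 ?_
  · exact mul_nonneg (a_pos n).le (by positivity)
  · simp [a]

lemma wronsk {t : ℝ} (ht : 0 ≤ t) :
    P a t * P (T b) t - P b t * P (T a) t ≤ P a t ^ 2 / 2 := by
  set w : ℝ → ℝ := fun t => P a t * P (T b) t - P b t * P (T a) t - P a t ^ 2 / 2 with hw
  have hc : Continuous w := by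
    have := P_cont E_a
    have := P_cont E_b
    have := P_cont (E_T E_a)
    have := P_cont (E_T E_b)
    fun_prop
  have hd : ∀ s : ℝ, 0 < s → HasDerivAt w 0 s := by
    intro s hs
    have hs' := hs.ne'
    have h := (((P_deriv E_a hs').mul (P_deriv (E_T E_b) hs')).sub
      ((P_deriv E_b hs').mul (P_deriv (E_T E_a) hs'))).sub
      (((P_deriv E_a hs').pow 2).div_const 2)
    refine h.congr_deriv ?_
    rw [P_TTa, P_TTb]
    field_simp
    push_cast
    ring
  have hanti : AntitoneOn w (Set.Ici 0) := by
    apply antitoneOn_of_deriv_nonpos (convex_Ici 0) hc.continuousOn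
    · intro s hs
      rw [interior_Ici] at hs
      exact (hd s hs).differentiableAt.differentiableWithinAt
    · intro s hs
      rw [interior_Ici] at hs
      exact (hd s hs).deriv.le
  have h0 := hanti (Set.mem_Ici.2 le_rfl) (Set.mem_Ici.2 ht) ht
  have h1 : w 0 ≤ 0 := by
    simp [hw, P_zero, T, a]
  simp only [hw] at h0 h1
  linarith

/-- ratio -/
def rat (t : ℝ) : ℝ := P b t / P a t - Real.log t / 2 - Real.eulerMascheroniConstant

lemma rat_anti : AntitoneOn rat (Set.Ioi 0) := by
  have hd : ∀ s : ℝ, 0 < s → HasDerivAt rat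
      ((P (T b) s / s * P a s - P b s * (P (T a) s / s)) / P a s ^ 2 - s⁻¹ / 2) s := by
    intro s hs
    exact (((P_deriv E_b hs.ne').div (P_deriv E_a hs.ne') (F_ge hs.le).ne').sub
      ((Real.hasDerivAt_log hs.ne').div_const 2)).sub_const _
  apply antitoneOn_of_deriv_nonpos (convex_Ioi 0)
  · intro s hs
    exact (hd s hs).continuousAt.continuousWithinAt
  · intro s hs
    rw [interior_Ioi] at hs
    exact (hd s hs).differentiableAt.differentiableWithinAt
  · intro s hs
    rw [interior_Ioi] at hs
    rw [(hd s hs).deriv]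
    have hs : 0 < s := hs
    have hF := F_ge hs.le
    have hW := wronsk hs.le
    have : (P (T b) s / s * P a s - P b s * (P (T a) s / s)) / P a s ^ 2 - s⁻¹ / 2
      = ((P a s * P (T b) s - P b s * P (T a) s) - P a s ^ 2 / 2) / (s * P a s ^ 2) := by
      field_simp
    rw [this]
    exact div_nonpos_of_nonpos_of_nonneg (by linarith) (by positivity)

lemma h_harm (n : ℕ) : harmonicNum n = (harmonic n : ℝ) := by
  simp [harmonicNum, harmonic]

lemma h_lower (n : ℕ) : Real.log (n + 1) + Real.eulerMascheroniConstant - 1 / ((n : ℝ) + 1)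
    ≤ harmonicNum n := by
  have h := Real.eulerMascheroniConstant_lt_eulerMascheroniSeq' (n + 1)
  rw [Real.eulerMascheroniSeq'] at h
  simp only [Nat.add_eq_zero_iff, one_ne_zero, and_false, if_false] at h
  rw [← h_harm, h_succ] at h
  push_cast at h
  linarith

lemma pointwise {t : ℝ} (ht : 0 < t) (n : ℕ) :
    1 / 2 - (1 / 2) * (t / ((n : ℝ) + 1) ^ 2) -
      ((1 / √t) / 2 + (1 / √t) / 2 * (t / ((n : ℝ) + 1) ^ 2))
    ≤ harmonicNum n - Real.log t / 2 - Real.eulerMascheroniConstant := by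
  have h := h_lower n
  have hn : (0 : ℝ) < (n : ℝ) + 1 := by positivity
  have hl := Real.log_le_sub_one_of_pos (by positivity : 0 < t / ((n : ℝ) + 1) ^ 2)
  rw [Real.log_div ht.ne' (by positivity), Real.log_pow] at hl
  push_cast at hl
  have hs : 0 < √t := Real.sqrt_pos.2 ht
  have hk : 1 / ((n : ℝ) + 1) ≤ (1 / √t) / 2 + (1 / √t) / 2 * (t / ((n : ℝ) + 1) ^ 2) := by
    have e : (1 / √t) / 2 + (1 / √t) / 2 * (t / ((n : ℝ) + 1) ^ 2) - 1 / ((n : ℝ) + 1)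
        = (√t - (n + 1)) ^ 2 / (2 * √t * ((n : ℝ) + 1) ^ 2) := by
      nth_rewrite 3 [← Real.sq_sqrt ht.le]
      field_simp
      ring
    have : 0 ≤ (√t - (n + 1)) ^ 2 / (2 * √t * ((n : ℝ) + 1) ^ 2) := by positivity
    linarith
  linarith

lemma rat_lower {t : ℝ} (ht : 0 < t) : -(1 / √t) ≤ rat t := by
  have hF := F_ge ht.le
  have hs : 0 < √t := Real.sqrt_pos.2 ht
  set k : ℝ := 1 / √t with hk
  have hk0 : 0 < k := by positivity
  have hsum1 : Summable fun n => a (n + 1) * t ^ (n + 1) := (summable_nat_add_iff 1).2 (E_a t)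
  have h1 : P a t = 1 + ∑' n, a (n + 1) * t ^ (n + 1) := by
    rw [P, (E_a t).tsum_eq_zero_add]; simp [a]
  set L : ℝ := Real.log t / 2 + Real.eulerMascheroniConstant with hL
  have key : ∑' n, ((1 / 2 - k / 2) * (a n * t ^ n) - (1 / 2 + k / 2) * (a (n + 1) * t ^ (n + 1)))
      ≤ ∑' n, (b n * t ^ n - L * (a n * t ^ n)) := by
    refine Summable.tsum_le_tsum ?_ (((E_a t).mul_left _).sub (hsum1.mul_left _))
      ((E_b t).sub ((E_a t).mul_left _))
    intro n
    have hp := mul_le_mul_of_nonneg_left (pointwise ht n)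
      (mul_nonneg (a_pos n).le (pow_nonneg ht.le n))
    rw [← hk] at hp
    rw [b_eq, a_succ, pow_succ]
    refine le_trans (le_of_eq ?_) (hp.trans (le_of_eq ?_))
    · field_simp
      ring
    · rw [hL]; ring
  rw [Summable.tsum_sub ((E_a t).mul_left _) (hsum1.mul_left _),
    Summable.tsum_sub (E_b t) ((E_a t).mul_left _), tsum_mul_left, tsum_mul_left,
    tsum_mul_left] at key
  change (1 / 2 - k / 2) * P a t - _ ≤ P b t - L * P a t at key
  have h2 : ∑' n, a (n + 1) * t ^ (n + 1) = P a t - 1 := by linarith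
  rw [h2] at key
  have e : rat t = (P b t - L * P a t) / P a t := by
    rw [rat, hL]; field_simp; ring
  rw [e, le_div_iff₀ hF]
  nlinarith

lemma rat_nonneg {t : ℝ} (ht : 0 < t) : 0 ≤ rat t := by
  by_contra hneg
  push Not at hneg
  set e := -rat t with he
  have he0 : 0 < e := by linarith
  set s : ℝ := max t ((2 / e) ^ 2) with hsd
  have hts : t ≤ s := le_max_left _ _
  have hs0 : 0 < s := ht.trans_le hts
  have h1 := rat_anti (Set.mem_Ioi.2 ht) (Set.mem_Ioi.2 hs0) hts
  have h2 := rat_lower hs0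
  have h3 : 2 / e ≤ √s := Real.le_sqrt_of_sq_le (le_max_right _ _)
  have h4 : 1 / √s ≤ e / 2 := by
    have := one_div_le_one_div_of_le (by positivity : 0 < 2 / e) h3
    rwa [one_div_div] at this
  linarith

theorem main (M : ℕ) (x : ℝ) (hx : 0 < x) :
    besselK0 x ≥ -(Real.log (x / 2) + Real.eulerMascheroniConstant)
      - ∑ n ∈ Finset.Icc 1 M, (1 / ((n.factorial : ℝ))^2) * (x^2 / 4)^n
          * (Real.log (x / 2) + Real.eulerMascheroniConstant - harmonicNum n) := by
  set t : ℝ := x ^ 2 / 4 with ht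
  have ht0 : 0 < t := by positivity
  have hlog : Real.log t / 2 = Real.log (x / 2) := by
    have : t = (x / 2) ^ 2 := by rw [ht]; ring
    rw [this, Real.log_pow]; push_cast; ring
  set L : ℝ := Real.log (x / 2) + Real.eulerMascheroniConstant with hL
  have hF := F_ge ht0.le
  have hI : besselI0 x = P a t := rfl
  have hPsi : besselPsi x = P b t := by
    rw [P, (E_b t).tsum_eq_zero_add]
    simp [b, harmonicNum, besselPsi, ← ht]
  have hK : besselK0 x = P b t - L * P a t := by
    rw [besselK0, hI, hPsi, ← hL]; ring
  have hKpos : 0 ≤ besselK0 x := by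
    have h := rat_nonneg ht0
    have e : rat t = (P b t - L * P a t) / P a t := by
      rw [rat, hlog, hL]; field_simp; ring
    rw [e] at h
    rw [hK]
    have := mul_nonneg h hF.le
    rwa [div_mul_cancel₀ _ hF.ne'] at this
  -- the summand
  set f : ℕ → ℝ := fun n => b n * t ^ n - L * (a n * t ^ n) with hf
  have hfs : Summable f := (E_b t).sub ((E_a t).mul_left _)
  have hfe : ∀ n, f n = a n * t ^ n * (harmonicNum n - L) := by
    intro n; simp only [hf, b_eq]; ring
  have hKf : besselK0 x = ∑' n, f n := by
    rw [hK, hf, Summable.tsum_sub (E_b t) ((E_a t).mul_left _), tsum_mul_left]; rfl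
  have hR : -L - ∑ n ∈ Finset.Icc 1 M, (1 / ((n.factorial : ℝ))^2) * t^n * (L - harmonicNum n)
      = ∑ n ∈ Finset.range (M + 1), f n := by
    have h0 : f 0 = -L := by simp [hfe, a, harmonicNum]
    induction M with
    | zero => simp [h0]
    | succ M ih =>
      rw [Finset.sum_Icc_succ_top (by omega), Finset.sum_range_succ, ← ih, hfe (M + 1), a]
      ring
  rw [hR, ge_iff_le]
  rcases le_total L (harmonicNum (M + 1)) with hc | hc
  · rw [hKf]
    refine hfs.sum_le_tsum _ fun n hn => ?_
    rw [hfe]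
    have : harmonicNum (M + 1) ≤ harmonicNum n := h_mono (by simpa using hn)
    exact mul_nonneg (mul_nonneg (a_pos n).le (by positivity)) (by linarith)
  · refine le_trans (Finset.sum_nonpos fun n hn => ?_) hKpos
    rw [hfe]
    have : harmonicNum n ≤ harmonicNum (M + 1) := h_mono (by
      have := Finset.mem_range.1 hn; omega)
    exact mul_nonpos_of_nonneg_of_nonpos (mul_nonneg (a_pos n).le (by positivity)) (by linarith)

end BK

/-- **Lower bound for `K₀` (Theorem B.1, part 1).** For every `M` and every `x > 0`,
`K₀(x) ≥ −(ln(x/2) + γ) − Σ_{n=1}^{M} (1/(n!)²)(x²/4)ⁿ (ln(x/2) + γ − hₙ)`. -/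
theorem besselK0_lower_bound (M : ℕ) (x : ℝ) (hx : 0 < x) :
    besselK0 x ≥ -(Real.log (x / 2) + Real.eulerMascheroniConstant)
      - ∑ n ∈ Finset.Icc 1 M, (1 / ((n.factorial : ℝ))^2) * (x^2 / 4)^n
          * (Real.log (x / 2) + Real.eulerMascheroniConstant - harmonicNum n) := by
  exact BK.main M x hx
end
end

section
/- For every a > 0 and λ > 0, ∫₀^∞ e^{−λt} · (1/(2πt)) · e^{−a²/(2t)} dt = (1/π) K₀(√(2λ)·a); that is, the Laplace transform in time of the planar heat kernel evaluated at distance a equals (1/π) times the modified Bessel function K₀ at √(2λ)·a. -/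
noncomputable section

open Filter Topology Set MeasureTheory

/-- Power series with coefficients `c`. -/
def hkS (c : ℕ → ℝ) (z : ℝ) : ℝ := ∑' n : ℕ, c n * z ^ n

lemma hkS_summable {c : ℕ → ℝ} {M : ℝ} (hc : ∀ n, |c n| ≤ M / (n.factorial : ℝ)) (z : ℝ) :
    Summable (fun n => c n * z ^ n) := by
  refine Summable.of_norm_bounded (g := fun n => M * (|z| ^ n / (n.factorial : ℝ)))
    ((Real.summable_pow_div_factorial |z|).mul_left M) ?_
  intro n
  rw [Real.norm_eq_abs, abs_mul, abs_pow]
  calc |c n| * |z| ^ n ≤ M / (n.factorial : ℝ) * |z| ^ n := by gcongr; exact hc n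
    _ = _ := by ring

lemma hkS_hasDerivAt {c : ℕ → ℝ} {M : ℝ} (hc : ∀ n, |c n| ≤ M / (n.factorial : ℝ)) (z : ℝ) :
    HasDerivAt (hkS c) (hkS (fun n => ((n : ℝ) + 1) * c (n + 1)) z) z := by
  have hM : 0 ≤ M := by
    have := (abs_nonneg _).trans (hc 0)
    simpa using this
  set R : ℝ := |z| + 1 with hR
  have hR0 : 0 < R := by positivity
  have key := hasDerivAt_tsum_of_isPreconnected (𝕜 := ℝ)
    (g := fun (n : ℕ) (y : ℝ) => c n * y ^ n) (g' := fun (n : ℕ) (y : ℝ) => c n * ((n : ℝ) * y ^ (n - 1)))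
    (u := fun n : ℕ => M / (n.factorial : ℝ) * ((n : ℝ) * R ^ (n - 1)))
    (t := Metric.ball (0 : ℝ) R) (y₀ := 0) (y := z) ?_ Metric.isOpen_ball
    (convex_ball _ _).isPreconnected ?_ ?_ ?_ (hkS_summable hc 0) ?_
  · have h2 : (∑' n : ℕ, c n * ((n : ℝ) * z ^ (n - 1)))
        = hkS (fun n => ((n : ℝ) + 1) * c (n + 1)) z := by
      rw [hkS, tsum_eq_zero_add']
      · simp only [Nat.cast_zero, zero_mul, mul_zero, zero_add, Nat.add_sub_cancel, Nat.cast_add,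
          Nat.cast_one]
        exact tsum_congr fun n => by ring
      · refine (hkS_summable (c := fun n => ((n : ℝ) + 1) * c (n + 1)) (M := M) ?_ z).congr ?_
        · intro n
          rw [abs_mul, abs_of_nonneg (by positivity)]
          have := hc (n + 1)
          calc ((n : ℝ) + 1) * |c (n + 1)| ≤ ((n : ℝ) + 1) * (M / ((n + 1).factorial : ℝ)) := by
                gcongr
            _ = _ := by
              rw [Nat.factorial_succ]; push_cast; field_simp
        · intro n
          simp only [Nat.add_sub_cancel, Nat.cast_add, Nat.cast_one]
          ring
    rw [← h2]
    exact key
  · rw [← summable_nat_add_iff 1]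
    refine ((Real.summable_pow_div_factorial R).mul_left M).congr ?_
    intro n
    rw [Nat.factorial_succ, Nat.add_sub_cancel]; push_cast
    field_simp
  · intro n y _
    exact (hasDerivAt_pow n y).const_mul (c n)
  · intro n y hy
    have hy' : |y| ≤ R := by simpa using (Metric.mem_ball.1 hy).le
    rw [Real.norm_eq_abs, abs_mul, abs_mul, abs_pow, Nat.abs_cast]
    gcongr
    exact hc n
  · simpa using hR0
  · simp [hR]

lemma hkS_split {c : ℕ → ℝ} {M : ℝ} (hc : ∀ n, |c n| ≤ M / (n.factorial : ℝ)) (z : ℝ) :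
    hkS c z = c 0 + z * hkS (fun n => c (n + 1)) z := by
  rw [hkS, (hkS_summable hc z).tsum_eq_zero_add, hkS, ← tsum_mul_left]
  simp only [pow_zero, mul_one]
  congr 1
  exact tsum_congr fun n => by ring

lemma hkS_zero (c : ℕ → ℝ) : hkS c 0 = c 0 := by
  rw [hkS, tsum_eq_single 0]
  · simp
  · intro n hn; simp [hn]

def hkc (n : ℕ) : ℝ := 1 / ((n.factorial : ℝ)) ^ 2
def hkp (n : ℕ) : ℝ := harmonicNum n / ((n.factorial : ℝ)) ^ 2

lemma harmonicNum_nonneg' (n : ℕ) : 0 ≤ harmonicNum n :=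
  Finset.sum_nonneg fun i _ => by positivity

lemma harmonicNum_le' (n : ℕ) : harmonicNum n ≤ n := by
  have : harmonicNum n ≤ ∑ i ∈ Finset.range n, (1 : ℝ) := by
    refine Finset.sum_le_sum fun i _ => ?_
    rw [div_le_one (by positivity)]
    have : (0 : ℝ) ≤ i := by positivity
    linarith
  simpa using this

lemma sq_le_two_fact (n : ℕ) : ((n : ℝ)) ^ 2 ≤ 2 * (n.factorial : ℝ) := by
  cases n with
  | zero => simp
  | succ k =>
    have h1 : k ≤ k.factorial := Nat.self_le_factorial k
    have h2 : 1 ≤ k.factorial := Nat.factorial_pos k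
    have h3 : (k + 1) ^ 2 ≤ 2 * (k + 1).factorial := by
      rw [Nat.factorial_succ]; nlinarith
    exact_mod_cast h3

lemma bound_aux (x : ℝ) (n : ℕ) (hx : 0 ≤ x) (h : x ≤ 2 * (n.factorial : ℝ)) :
    |x / ((n.factorial : ℝ)) ^ 2| ≤ 2 / (n.factorial : ℝ) := by
  have hf : (0 : ℝ) < n.factorial := by exact_mod_cast Nat.factorial_pos n
  rw [abs_of_nonneg (by positivity), div_le_div_iff₀ (by positivity) hf]
  nlinarith

lemma nat_le_two_fact (n : ℕ) : (n : ℝ) ≤ 2 * (n.factorial : ℝ) := by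
  have h1 : n ≤ n.factorial := Nat.self_le_factorial n
  have : n ≤ 2 * n.factorial := by omega
  exact_mod_cast this

lemma hkc_bound (n : ℕ) : |hkc n| ≤ 2 / (n.factorial : ℝ) := by
  apply bound_aux _ _ zero_le_one
  have : 1 ≤ n.factorial := Nat.factorial_pos n
  have : (1 : ℝ) ≤ n.factorial := by exact_mod_cast this
  linarith

lemma hkp_bound (n : ℕ) : |hkp n| ≤ 2 / (n.factorial : ℝ) :=
  bound_aux _ _ (harmonicNum_nonneg' n) ((harmonicNum_le' n).trans (nat_le_two_fact n))

lemma hkc1_bound (n : ℕ) : |(n : ℝ) * hkc n| ≤ 2 / (n.factorial : ℝ) := by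
  have := bound_aux n n (by positivity) (nat_le_two_fact n)
  rw [hkc, mul_one_div]; exact this

lemma hkp1_bound (n : ℕ) : |(n : ℝ) * hkp n| ≤ 2 / (n.factorial : ℝ) := by
  rw [hkp, ← mul_div_assoc]
  refine bound_aux _ n (mul_nonneg (by positivity) (harmonicNum_nonneg' n)) ?_
  refine le_trans ?_ (sq_le_two_fact n)
  rw [sq]; gcongr; exact harmonicNum_le' n

def hkI : ℝ → ℝ := hkS hkc
def hkA : ℝ → ℝ := hkS (fun n => n * hkc n)
def hkP : ℝ → ℝ := hkS hkp
def hkB : ℝ → ℝ := hkS (fun n => n * hkp n)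

lemma hkI_deriv {z : ℝ} (hz : 0 < z) : HasDerivAt hkI (hkA z / z) z := by
  have h := hkS_hasDerivAt hkc_bound z
  have h2 := hkS_split hkc1_bound z
  have : hkA z / z = hkS (fun n => ((n : ℝ) + 1) * hkc (n + 1)) z := by
    rw [hkA, h2]; simp [hz.ne']
  rw [this]; exact h

lemma hkP_deriv {z : ℝ} (hz : 0 < z) : HasDerivAt hkP (hkB z / z) z := by
  have h := hkS_hasDerivAt hkp_bound z
  have h2 := hkS_split hkp1_bound z
  have : hkB z / z = hkS (fun n => ((n : ℝ) + 1) * hkp (n + 1)) z := by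
    rw [hkB, h2]; simp [hz.ne']
  rw [this]; exact h

lemma hkA_deriv (z : ℝ) : HasDerivAt hkA (hkI z) z := by
  have h := hkS_hasDerivAt hkc1_bound z
  have : (fun n : ℕ => ((n : ℝ) + 1) * (((n + 1 : ℕ) : ℝ) * hkc (n + 1))) = hkc := by
    funext n
    have hf : (0 : ℝ) < n.factorial := by exact_mod_cast Nat.factorial_pos n
    simp only [hkc, Nat.factorial_succ]; push_cast; field_simp
  rw [this] at h; exact h

lemma hkB_deriv {z : ℝ} (hz : 0 < z) : HasDerivAt hkB (hkP z + hkA z / z) z := by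
  have h := hkS_hasDerivAt hkp1_bound z
  have h2 : (fun n : ℕ => ((n : ℝ) + 1) * (((n + 1 : ℕ) : ℝ) * hkp (n + 1)))
      = fun n : ℕ => hkp n + ((n : ℝ) + 1) * hkc (n + 1) := by
    funext n
    have hf : (0 : ℝ) < n.factorial := by exact_mod_cast Nat.factorial_pos n
    simp only [hkc, hkp, Nat.factorial_succ, harmonicNum, Finset.sum_range_succ]
    push_cast; field_simp
  have h3 := hkS_split hkc1_bound z
  have h4 : hkA z / z = hkS (fun n => ((n : ℝ) + 1) * hkc (n + 1)) z := by
    rw [hkA, h3]; simp [hz.ne']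
  rw [h2] at h
  have h5 : hkS (fun n : ℕ => hkp n + ((n : ℝ) + 1) * hkc (n + 1)) z = hkP z + hkA z / z := by
    rw [h4, hkP, hkS, hkS, hkS, ← Summable.tsum_add (hkS_summable hkp_bound z)]
    · exact tsum_congr fun n => by ring
    · refine hkS_summable (c := fun n : ℕ => ((n : ℝ) + 1) * hkc (n + 1)) (M := 2) ?_ z
      intro n
      have h6 := hkc1_bound (n + 1)
      push_cast at h6
      refine h6.trans ?_
      gcongr
      exact Nat.le_succ n
  rw [h5] at h; exact h

lemma hkI_pos {z : ℝ} (hz : 0 < z) : 0 < hkI z := by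
  refine (hkS_summable hkc_bound z).tsum_pos (fun n => ?_) 0 ?_
  · rw [hkc]; positivity
  · rw [hkc]; positivity

/-- `log z * (hkS c z - c 0) → 0`. -/
lemma log_hkS {c : ℕ → ℝ} {M : ℝ} (hc : ∀ n, |c n| ≤ M / (n.factorial : ℝ)) :
    Tendsto (fun z => Real.log z * (hkS c z - c 0)) (𝓝[>] 0) (𝓝 0) := by
  have hM : 0 ≤ M := by
    have := (abs_nonneg _).trans (hc 0)
    simpa using this
  have h1 : Tendsto (fun z => hkS (fun n => c (n + 1)) z) (𝓝[>] 0)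
      (𝓝 (hkS (fun n => c (n + 1)) 0)) := by
    refine tendsto_nhdsWithin_of_tendsto_nhds
      (hkS_hasDerivAt (c := fun n => c (n + 1)) (M := M) ?_ 0).continuousAt
    intro n
    refine (hc (n + 1)).trans ?_
    gcongr
    exact Nat.le_succ n
  have h2 : Tendsto (fun z : ℝ => Real.log z * z) (𝓝[>] 0) (𝓝 0) := by
    simpa using tendsto_log_mul_rpow_nhdsGT_zero zero_lt_one
  have h3 := h2.mul h1
  rw [zero_mul] at h3
  refine h3.congr fun z => ?_
  rw [hkS_split hc z]; ring

lemma hkS_tendsto {c : ℕ → ℝ} {M : ℝ} (hc : ∀ n, |c n| ≤ M / (n.factorial : ℝ)) :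
    Tendsto (hkS c) (𝓝[>] 0) (𝓝 (c 0)) := by
  have := (hkS_hasDerivAt hc 0).continuousAt.tendsto
  rw [hkS_zero] at this
  exact tendsto_nhdsWithin_of_tendsto_nhds this

/-- The integrand `e^{-s-z/s}`. -/
def hke (z s : ℝ) : ℝ := Real.exp (-s - z / s)

def hkJ (k : ℕ) (z : ℝ) : ℝ := ∫ s in Ioi (0 : ℝ), hke z s / s ^ k

lemma hke_meas (z : ℝ) : Measurable (hke z) := by
  unfold hke; fun_prop

lemma hke_bound (k : ℕ) {c z s : ℝ} (hc : 0 < c) (hcz : c ≤ z) (hs : 0 < s) :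
    hke z s / s ^ k ≤ (k.factorial : ℝ) / c ^ k * Real.exp (-s) := by
  have h1 : (c / s) ^ k / (k.factorial : ℝ) ≤ Real.exp (c / s) :=
    Real.pow_div_factorial_le_exp _ (by positivity) k
  have h2 : Real.exp (-(z / s)) ≤ Real.exp (-(c / s)) := by gcongr
  have hf : (0 : ℝ) < k.factorial := by exact_mod_cast Nat.factorial_pos k
  have h3 : Real.exp (-(c / s)) / s ^ k ≤ (k.factorial : ℝ) / c ^ k := by
    rw [Real.exp_neg, div_le_div_iff₀ (by positivity) (by positivity),
      inv_mul_le_iff₀ (Real.exp_pos _)]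
    rw [div_le_iff₀ hf, div_pow, div_le_iff₀ (by positivity)] at h1
    linarith
  have : hke z s = Real.exp (-s) * Real.exp (-(z / s)) := by
    rw [hke, ← Real.exp_add]; congr 1
  rw [this]
  calc Real.exp (-s) * Real.exp (-(z / s)) / s ^ k
      ≤ Real.exp (-s) * Real.exp (-(c / s)) / s ^ k := by gcongr
    _ = Real.exp (-s) * (Real.exp (-(c / s)) / s ^ k) := by ring
    _ ≤ Real.exp (-s) * ((k.factorial : ℝ) / c ^ k) := by gcongr
    _ = _ := by ring

lemma hke_pos (z s : ℝ) : 0 < hke z s := Real.exp_pos _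

lemma hke_int (k : ℕ) {z : ℝ} (hz : 0 < z) :
    IntegrableOn (fun s => hke z s / s ^ k) (Ioi 0) := by
  refine Integrable.mono' ((integrableOn_exp_neg_Ioi 0).const_mul ((k.factorial : ℝ) / z ^ k))
    ((hke_meas z).div (by fun_prop)).aestronglyMeasurable ?_
  filter_upwards [ae_restrict_mem measurableSet_Ioi] with s hs
  have hs : 0 < s := hs
  rw [Real.norm_of_nonneg (by have := hke_pos z s; positivity)]
  exact hke_bound k hz le_rfl hs

lemma hkJ_deriv (k : ℕ) {z : ℝ} (hz : 0 < z) : HasDerivAt (hkJ k) (-hkJ (k + 1) z) z := by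
  have key := hasDerivAt_integral_of_dominated_loc_of_deriv_le (𝕜 := ℝ)
    (μ := volume.restrict (Ioi (0 : ℝ)))
    (F := fun z s => hke z s / s ^ k) (F' := fun z s => -(hke z s / s ^ (k + 1)))
    (x₀ := z) (s := Ioi (z / 2))
    (bound := fun s => ((k + 1).factorial : ℝ) / (z / 2) ^ (k + 1) * Real.exp (-s))
    (Ioi_mem_nhds (by linarith)) ?_ (hke_int k hz) ?_ ?_ ?_ ?_
  · have := key.2
    rw [integral_neg] at this
    exact this
  · exact Eventually.of_forall fun y => ((hke_meas y).div (by fun_prop)).aestronglyMeasurable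
  · exact ((hke_meas z).div (by fun_prop)).neg.aestronglyMeasurable
  · filter_upwards [ae_restrict_mem measurableSet_Ioi] with s hs y hy
    have hs : 0 < s := hs
    have hy : z / 2 < y := hy
    rw [norm_neg, Real.norm_of_nonneg (by have := hke_pos y s; positivity)]
    exact hke_bound (k + 1) (by positivity) hy.le hs
  · exact (integrableOn_exp_neg_Ioi 0).const_mul _
  · filter_upwards [ae_restrict_mem measurableSet_Ioi] with s hs y hy
    have hs : 0 < s := hs
    have h1 : HasDerivAt (fun y : ℝ => -s - y / s) (-(1 / s)) y :=
      ((hasDerivAt_id y).div_const s).const_sub (-s)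
    have h2 := h1.exp.div_const (s ^ k)
    refine HasDerivAt.congr_deriv h2 ?_
    simp only [hke]
    field_simp
    ring

/-- Inversion `s ↦ z / s`. -/
lemma subst_inv {z : ℝ} (hz : 0 < z) (g : ℝ → ℝ) :
    ∫ s in Ioi (0 : ℝ), g s = ∫ s in Ioi (0 : ℝ), z / s ^ 2 * g (z / s) := by
  have him : (fun s : ℝ => z / s) '' Ioi 0 = Ioi 0 := by
    ext y
    constructor
    · rintro ⟨s, hs, rfl⟩
      exact div_pos hz hs
    · intro hy
      have hy : 0 < y := hy
      exact ⟨z / y, div_pos hz hy, by simp only; field_simp⟩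
  have := integral_image_eq_integral_abs_deriv_smul (f := fun s : ℝ => z / s)
    (f' := fun s => -(z / s ^ 2)) (s := Ioi 0) measurableSet_Ioi ?_ ?_ g
  · rw [him] at this
    rw [this]
    refine setIntegral_congr_fun measurableSet_Ioi fun s hs => ?_
    have hs : 0 < s := hs
    simp only [smul_eq_mul, abs_neg]
    rw [abs_of_pos (by positivity)]
  · intro s hs
    have hs : 0 < s := hs
    have := ((hasDerivAt_const s z).div (hasDerivAt_id s) hs.ne').hasDerivWithinAt (s := Ioi 0)
    refine HasDerivWithinAt.congr_deriv this ?_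
    simp [neg_div]
  · intro x hx y hy h
    have hx : 0 < x := hx
    have hy : 0 < y := hy
    simp only at h
    field_simp at h
    exact h.symm

lemma hke_inv {z s : ℝ} (hz : 0 < z) (hs : 0 < s) : hke z (z / s) = hke z s := by
  unfold hke; congr 1; field_simp; ring

lemma hkJ2 {z : ℝ} (hz : 0 < z) : hkJ 2 z = hkJ 0 z / z := by
  rw [eq_div_iff hz.ne']
  simp only [hkJ, pow_zero, div_one]
  rw [subst_inv hz (hke z), ← integral_mul_const]
  refine setIntegral_congr_fun measurableSet_Ioi fun s hs => ?_
  have hs : 0 < s := hs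
  simp only [hke_inv hz hs]
  ring

lemma abs_log_le {s : ℝ} (hs : 0 < s) : |Real.log s| ≤ s + 2 * s ^ ((1 / 2 : ℝ) - 1) := by
  have h0 : 0 ≤ s ^ ((1 / 2 : ℝ) - 1) := by positivity
  rw [abs_le]
  constructor
  · have h := Real.log_le_rpow_div (x := s⁻¹) (ε := 1 / 2) (by positivity) (by norm_num)
    rw [Real.log_inv, Real.inv_rpow hs.le, ← Real.rpow_neg hs.le] at h
    norm_num at h ⊢
    linarith
  · have := Real.log_le_sub_one_of_pos hs
    linarith

lemma log_exp_int : IntegrableOn (fun s => |Real.log s| * Real.exp (-s)) (Ioi 0) := by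
  have h1 := Real.GammaIntegral_convergent (s := 2) (by norm_num)
  have h2 := Real.GammaIntegral_convergent (s := 1 / 2) (by norm_num)
  refine Integrable.mono' (h1.add (h2.const_mul 2)) (by fun_prop) ?_
  filter_upwards [ae_restrict_mem measurableSet_Ioi] with s hs
  have hs : 0 < s := hs
  rw [Real.norm_of_nonneg (by positivity)]
  have := abs_log_le hs
  simp only [Pi.add_apply]
  have e : (2 : ℝ) - 1 = 1 := by norm_num
  rw [e, Real.rpow_one]
  calc |Real.log s| * Real.exp (-s) ≤ (s + 2 * s ^ ((1 / 2 : ℝ) - 1)) * Real.exp (-s) := by gcongr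
    _ = _ := by ring

lemma log_hke_int (k : ℕ) {z : ℝ} (hz : 0 < z) :
    IntegrableOn (fun s => Real.log s * (hke z s / s ^ k)) (Ioi 0) := by
  refine Integrable.mono' (log_exp_int.const_mul ((k.factorial : ℝ) / z ^ k))
    (Real.measurable_log.mul ((hke_meas z).div (by fun_prop))).aestronglyMeasurable ?_
  filter_upwards [ae_restrict_mem measurableSet_Ioi] with s hs
  have hs : 0 < s := hs
  have h := hke_bound k hz le_rfl hs
  rw [norm_mul, Real.norm_eq_abs, Real.norm_of_nonneg (by have := hke_pos z s; positivity)]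
  calc |Real.log s| * (hke z s / s ^ k)
      ≤ |Real.log s| * ((k.factorial : ℝ) / z ^ k * Real.exp (-s)) := by gcongr
    _ = _ := by ring

def hkL (z : ℝ) : ℝ := ∫ s in Ioi (0 : ℝ), Real.log s * hke z s

lemma log_exp_gamma : ∫ s in Ioi (0 : ℝ), Real.log s * Real.exp (-s)
    = -Real.eulerMascheroniConstant := by
  have h1 := Complex.hasDerivAt_GammaIntegral (s := 1) (by simp)
  have h2 := Complex.hasDerivAt_Gamma_one
  have h3 : HasDerivAt Complex.GammaIntegral (-(Real.eulerMascheroniConstant : ℂ)) 1 := by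
    refine h2.congr_of_eventuallyEq ?_
    have : {s : ℂ | 0 < s.re} ∈ 𝓝 (1 : ℂ) :=
      (isOpen_lt continuous_const Complex.continuous_re).mem_nhds (by simp)
    filter_upwards [this] with s hs
    exact (Complex.Gamma_eq_integral hs).symm
  have h4 := h1.unique h3
  simp only [sub_self, Complex.cpow_zero, one_mul] at h4
  have h5 : ((∫ s in Ioi (0 : ℝ), Real.log s * Real.exp (-s) : ℝ) : ℂ)
      = ((-Real.eulerMascheroniConstant : ℝ) : ℂ) := by
    rw [← integral_complex_ofReal]
    push_cast
    rw [← h4]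
    refine integral_congr_ae (Eventually.of_forall fun s => ?_)
    simp
  exact_mod_cast h5

lemma hkL_tendsto : Tendsto hkL (𝓝[>] 0) (𝓝 (-Real.eulerMascheroniConstant)) := by
  rw [← log_exp_gamma]
  refine tendsto_integral_filter_of_dominated_convergence
    (fun s => |Real.log s| * Real.exp (-s)) ?_ ?_ log_exp_int ?_
  · exact Eventually.of_forall fun z =>
      (Real.measurable_log.mul (hke_meas z)).aestronglyMeasurable
  · filter_upwards [self_mem_nhdsWithin] with z hz
    have hz : 0 < z := hz
    filter_upwards [ae_restrict_mem measurableSet_Ioi] with s hs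
    have hs : 0 < s := hs
    rw [norm_mul, Real.norm_eq_abs, Real.norm_of_nonneg (hke_pos z s).le]
    unfold hke
    gcongr
    have : 0 < z / s := by positivity
    linarith
  · filter_upwards with s
    have : Continuous fun z : ℝ => Real.log s * hke z s := by unfold hke; fun_prop
    have h := (this.tendsto 0)
    simp only [hke, zero_div, sub_zero] at h
    exact tendsto_nhdsWithin_of_tendsto_nhds h

lemma hkJ0_bound {z : ℝ} (hz : 0 < z) : |hkJ 0 z - 1| ≤ z ^ (1 / 2 : ℝ) * Real.Gamma (1 / 2) := by
  have hI := hke_int 0 hz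
  have h01 : hkJ 0 z - 1 = ∫ s in Ioi (0 : ℝ), (hke z s / s ^ 0 - Real.exp (-s)) := by
    rw [integral_sub hI (integrableOn_exp_neg_Ioi 0), integral_exp_neg_Ioi_zero]; rfl
  rw [h01, Real.Gamma_eq_integral (by norm_num), ← integral_const_mul, ← Real.norm_eq_abs]
  refine norm_integral_le_of_norm_le
    ((Real.GammaIntegral_convergent (s := 1 / 2) (by norm_num)).const_mul _) ?_
  filter_upwards [ae_restrict_mem measurableSet_Ioi] with s hs
  have hs : 0 < s := hs
  have hq : 0 < z / s := by positivity
  have h1 : hke z s = Real.exp (-s) * Real.exp (-(z / s)) := by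
    rw [hke, ← Real.exp_add]; congr 1
  have h2 : 1 - Real.exp (-(z / s)) ≤ (z / s) ^ (1 / 2 : ℝ) := by
    rcases le_total (z / s) 1 with h | h
    · have h3 := Real.add_one_le_exp (-(z / s))
      have h4 : (z / s) ^ (1 : ℝ) ≤ (z / s) ^ (1 / 2 : ℝ) :=
        Real.rpow_le_rpow_of_exponent_ge hq h (by norm_num)
      rw [Real.rpow_one] at h4
      linarith
    · have h3 : 1 ≤ (z / s) ^ (1 / 2 : ℝ) := Real.one_le_rpow h (by norm_num)
      have := Real.exp_pos (-(z / s))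
      linarith
  have h5 : Real.exp (-(z / s)) ≤ 1 := by rw [Real.exp_le_one_iff]; linarith
  have h6 : (z / s) ^ (1 / 2 : ℝ) = z ^ (1 / 2 : ℝ) * s ^ ((1 / 2 : ℝ) - 1) := by
    rw [Real.div_rpow hz.le hs.le, show (1 / 2 : ℝ) - 1 = -(1 / 2) by norm_num,
      Real.rpow_neg hs.le, div_eq_mul_inv]
  rw [pow_zero, div_one, h1, Real.norm_eq_abs, abs_sub_comm, ← mul_one_sub, abs_of_nonneg
    (mul_nonneg (Real.exp_pos _).le (by linarith))]
  calc Real.exp (-s) * (1 - Real.exp (-(z / s))) ≤ Real.exp (-s) * (z / s) ^ (1 / 2 : ℝ) := by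
        gcongr
    _ = _ := by rw [h6]; ring

lemma log_hkJ0 : Tendsto (fun z => Real.log z * (hkJ 0 z - 1)) (𝓝[>] 0) (𝓝 0) := by
  have h := (tendsto_log_mul_rpow_nhdsGT_zero (r := 1 / 2) (by norm_num)).abs.mul_const
    (Real.Gamma (1 / 2))
  rw [abs_zero, zero_mul] at h
  refine squeeze_zero_norm' ?_ h
  filter_upwards [self_mem_nhdsWithin] with z hz
  have hz : 0 < z := hz
  have hb := hkJ0_bound hz
  rw [Real.norm_eq_abs, abs_mul, abs_mul, abs_of_nonneg (a := z ^ (1 / 2 : ℝ)) (by positivity),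
    mul_assoc]
  gcongr

lemma hkJ0_tendsto : Tendsto (hkJ 0) (𝓝[>] 0) (𝓝 1) := by
  have h : Tendsto (fun z : ℝ => z ^ (1 / 2 : ℝ) * Real.Gamma (1 / 2)) (𝓝[>] 0) (𝓝 0) := by
    have : Continuous fun z : ℝ => z ^ (1 / 2 : ℝ) * Real.Gamma (1 / 2) :=
      (Real.continuous_rpow_const (by norm_num)).mul continuous_const
    have h := this.tendsto 0
    rw [Real.zero_rpow (by norm_num), zero_mul] at h
    exact tendsto_nhdsWithin_of_tendsto_nhds h
  rw [← tendsto_sub_nhds_zero_iff]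
  refine squeeze_zero_norm' ?_ h
  filter_upwards [self_mem_nhdsWithin] with z hz
  exact hkJ0_bound hz

lemma hkJ1_eq {z : ℝ} (hz : 0 < z) : hkJ 1 z = 2 * hkL z - Real.log z * hkJ 0 z := by
  have hi0 := log_hke_int 0 hz
  have hi2 := log_hke_int 2 hz
  simp only [pow_zero, div_one] at hi0
  have hlim : ∀ s : ℝ, 0 < s → |Real.log s * hke z s|
      ≤ (s * 1 + 2 * (1 / z * s ^ (1 / 2 : ℝ))) * Real.exp (-s) := by
    intro s hs
    have h0 := hke_bound 0 hz le_rfl hs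
    have h1 := hke_bound 1 hz le_rfl hs
    have hl := abs_log_le hs
    simp only [Nat.factorial_zero, Nat.factorial_one, Nat.cast_one, pow_zero, pow_one, div_one,
      one_mul] at h0 h1
    rw [div_le_iff₀ hs] at h1
    have e : s ^ ((1 / 2 : ℝ) - 1) * s = s ^ (1 / 2 : ℝ) := by
      rw [Real.rpow_sub_one hs.ne']; field_simp
    rw [abs_mul, abs_of_pos (hke_pos z s)]
    have hp : 0 ≤ s ^ ((1 / 2 : ℝ) - 1) := by positivity
    calc |Real.log s| * hke z s ≤ (s + 2 * s ^ ((1 / 2 : ℝ) - 1)) * hke z s := by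
          have := hke_pos z s
          gcongr
      _ = s * hke z s + 2 * s ^ ((1 / 2 : ℝ) - 1) * hke z s := by ring
      _ ≤ s * Real.exp (-s) + 2 * s ^ ((1 / 2 : ℝ) - 1) * (1 / z * Real.exp (-s) * s) := by
          gcongr
      _ = s * Real.exp (-s) + 2 * (s ^ ((1 / 2 : ℝ) - 1) * s) * (1 / z * Real.exp (-s)) := by ring
      _ = _ := by rw [e]; ring
  have key := integral_Ioi_mul_deriv_eq_deriv_mul (a := (0 : ℝ)) (a' := (0 : ℝ)) (b' := (0 : ℝ))
    (u := Real.log) (u' := fun s => s⁻¹)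
    (v := hke z) (v' := fun s => (-1 + z / s ^ 2) * hke z s) ?_ ?_ ?_ ?_ ?_ ?_
  · have e1 : ∫ s in Ioi (0 : ℝ), s⁻¹ * hke z s = hkJ 1 z := by
      refine setIntegral_congr_fun measurableSet_Ioi fun s hs => ?_
      simp only [pow_one]; ring
    have e2 : ∫ s in Ioi (0 : ℝ), Real.log s * ((-1 + z / s ^ 2) * hke z s)
        = -hkL z + z * ∫ s in Ioi (0 : ℝ), Real.log s * (hke z s / s ^ 2) := by
      have e5 : -hkL z = ∫ s in Ioi (0 : ℝ), (-fun s => Real.log s * hke z s) s := by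
        rw [hkL, ← integral_neg]; rfl
      rw [e5, ← integral_const_mul, ← integral_add hi0.neg (hi2.const_mul z)]
      refine setIntegral_congr_fun measurableSet_Ioi fun s hs => ?_
      simp only [Pi.neg_apply]; ring
    have e3 : hkL z = Real.log z * hkJ 0 z
        - z * ∫ s in Ioi (0 : ℝ), Real.log s * (hke z s / s ^ 2) := by
      have e4 : Real.log z * hkJ 0 z = ∫ s in Ioi (0 : ℝ), z * Real.log z * (hke z s / s ^ 2) := by
        rw [integral_const_mul]
        have := hkJ2 hz
        rw [eq_div_iff hz.ne'] at this
        rw [← this, hkJ]; ring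
      rw [e4, ← integral_const_mul, ← integral_sub ((hke_int 2 hz).const_mul _) (hi2.const_mul z),
        hkL, subst_inv hz]
      refine setIntegral_congr_fun measurableSet_Ioi fun s hs => ?_
      have hs : 0 < s := hs
      simp only [hke_inv hz hs, Real.log_div hz.ne' hs.ne']
      ring
    rw [e1, e2] at key
    linarith
  · intro s hs
    exact Real.hasDerivAt_log (ne_of_gt hs)
  · intro s hs
    have hs : 0 < s := hs
    have h1 : HasDerivAt (fun s : ℝ => -s - z / s) (-1 + z / s ^ 2) s := by
      have h2 := (hasDerivAt_id s).neg.sub ((hasDerivAt_const s z).div (hasDerivAt_id s) hs.ne')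
      refine HasDerivAt.congr_deriv h2 ?_
      simp [neg_div]
    have := h1.exp
    rw [mul_comm] at this
    exact this
  · refine (hi0.neg.add (hi2.const_mul z)).congr_fun (fun s hs => ?_) measurableSet_Ioi
    simp only [Pi.neg_apply, Pi.add_apply, Pi.mul_apply]; ring
  · refine (hke_int 1 hz).congr_fun (fun s hs => ?_) measurableSet_Ioi
    simp only [Pi.mul_apply, pow_one]; ring
  · have hc : Continuous fun s : ℝ => (s * 1 + 2 * (1 / z * s ^ (1 / 2 : ℝ))) * Real.exp (-s) := by
      have : Continuous fun s : ℝ => s ^ (1 / 2 : ℝ) := Real.continuous_rpow_const (by norm_num)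
      fun_prop
    have h := hc.tendsto 0
    rw [Real.zero_rpow (by norm_num)] at h
    simp only [zero_mul, mul_zero, add_zero] at h
    refine squeeze_zero_norm' ?_ (tendsto_nhdsWithin_of_tendsto_nhds h)
    filter_upwards [self_mem_nhdsWithin] with s hs
    exact hlim s hs
  · have g1 : Tendsto (fun s : ℝ => s ^ (1 : ℝ) * Real.exp (-1 * s)) atTop (𝓝 0) :=
      tendsto_rpow_mul_exp_neg_mul_atTop_nhds_zero 1 1 one_pos
    have g2 : Tendsto (fun s : ℝ => s ^ (1 / 2 : ℝ) * Real.exp (-1 * s)) atTop (𝓝 0) :=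
      tendsto_rpow_mul_exp_neg_mul_atTop_nhds_zero (1 / 2) 1 one_pos
    have g3 := g1.add (g2.const_mul (2 * (1 / z)))
    rw [mul_zero, add_zero] at g3
    refine squeeze_zero_norm' ?_ g3
    filter_upwards [eventually_gt_atTop 0] with s hs
    refine (hlim s hs).trans (le_of_eq ?_)
    rw [Real.rpow_one, neg_one_mul]; ring

lemma hkJ1_tendsto : Tendsto (fun z => hkJ 1 z + Real.log z + 2 * Real.eulerMascheroniConstant)
    (𝓝[>] 0) (𝓝 0) := by
  have h := ((hkL_tendsto.const_mul 2).sub log_hkJ0).add_const (2 * Real.eulerMascheroniConstant)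
  have e : 2 * -Real.eulerMascheroniConstant - 0 + 2 * Real.eulerMascheroniConstant = 0 := by ring
  rw [e] at h
  refine h.congr' ?_
  filter_upwards [self_mem_nhdsWithin] with z hz
  rw [hkJ1_eq hz]; ring

lemma const_zero_of_deriv {f : ℝ → ℝ} (hd : ∀ z, 0 < z → HasDerivAt f 0 z)
    (hl : Tendsto f (𝓝[>] 0) (𝓝 0)) {z : ℝ} (hz : 0 < z) : f z = 0 := by
  have hc : ∀ y, 0 < y → f y = f z := by
    intro y hy
    refine (convex_Ioi (0 : ℝ)).is_const_of_fderivWithin_eq_zero (𝕜 := ℝ)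
      (fun x hx => (hd x hx).differentiableAt.differentiableWithinAt) (fun x hx => ?_) hy hz
    rw [fderivWithin_of_isOpen isOpen_Ioi hx]
    ext
    simpa using (hd x hx).deriv
  have h2 : Tendsto f (𝓝[>] 0) (𝓝 (f z)) := by
    refine tendsto_const_nhds.congr' ?_
    filter_upwards [self_mem_nhdsWithin] with y hy
    exact (hc y hy).symm
  exact tendsto_nhds_unique h2 hl

lemma hkJ1_formula {z : ℝ} (hz : 0 < z) :
    hkJ 1 z = -(Real.log z + 2 * Real.eulerMascheroniConstant) * hkI z + 2 * hkP z := by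
  set g := Real.eulerMascheroniConstant with hg
  let D : ℝ → ℝ := fun z => hkJ 1 z + (Real.log z + 2 * g) * hkI z - 2 * hkP z
  let E : ℝ → ℝ := fun z => -hkJ 0 z + hkI z + (Real.log z + 2 * g) * hkA z - 2 * hkB z
  have hD : ∀ z, 0 < z → HasDerivAt D (E z / z) z := by
    intro z hz
    have h := ((hkJ_deriv 1 hz).add (((Real.hasDerivAt_log hz.ne').add_const (2 * g)).mul
      (hkI_deriv hz))).sub ((hkP_deriv hz).const_mul 2)
    refine h.congr_deriv ?_
    rw [hkJ2 hz]
    simp only [E]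
    field_simp
    ring
  have hE : ∀ z, 0 < z → HasDerivAt E (D z) z := by
    intro z hz
    have h := ((hkJ_deriv 0 hz).neg.add (hkI_deriv hz)).add
      (((Real.hasDerivAt_log hz.ne').add_const (2 * g)).mul (hkA_deriv z)) |>.sub
      ((hkB_deriv hz).const_mul 2)
    refine h.congr_deriv ?_
    simp only [D]
    field_simp
    ring
  have c0 : hkc 0 = 1 := by simp [hkc]
  have p0 : hkp 0 = 0 := by simp [hkp, harmonicNum]
  have tI : Tendsto hkI (𝓝[>] 0) (𝓝 1) := c0 ▸ hkS_tendsto hkc_bound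
  have tP : Tendsto hkP (𝓝[>] 0) (𝓝 0) := p0 ▸ hkS_tendsto hkp_bound
  have tA : Tendsto hkA (𝓝[>] 0) (𝓝 0) := by simpa using! hkS_tendsto hkc1_bound
  have tB : Tendsto hkB (𝓝[>] 0) (𝓝 0) := by simpa using! hkS_tendsto hkp1_bound
  have lI : Tendsto (fun z => Real.log z * (hkI z - 1)) (𝓝[>] 0) (𝓝 0) := by
    have := log_hkS hkc_bound
    rw [c0] at this; exact this
  have lA : Tendsto (fun z => Real.log z * hkA z) (𝓝[>] 0) (𝓝 0) := by
    have := log_hkS hkc1_bound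
    simpa using! this
  have tD : Tendsto D (𝓝[>] 0) (𝓝 0) := by
    have h := ((hkJ1_tendsto.add lI).add ((tI.sub_const 1).const_mul (2 * g))).sub (tP.const_mul 2)
    have e : (0 : ℝ) + 0 + 2 * g * (1 - 1) - 2 * 0 = 0 := by ring
    rw [e] at h
    refine h.congr fun z => ?_
    simp only [D]; ring
  have tE : Tendsto E (𝓝[>] 0) (𝓝 0) := by
    have h := ((hkJ0_tendsto.neg.add tI).add (lA.add (tA.const_mul (2 * g)))).sub (tB.const_mul 2)
    have e : -(1 : ℝ) + 1 + (0 + 2 * g * 0) - 2 * 0 = 0 := by ring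
    rw [e] at h
    refine h.congr fun z => ?_
    simp only [E]; ring
  have hW : ∀ z, 0 < z → E z * hkI z - D z * hkA z = 0 := by
    intro z hz
    refine const_zero_of_deriv (f := fun z => E z * hkI z - D z * hkA z) ?_ ?_ hz
    · intro z hz
      refine (((hE z hz).mul (hkI_deriv hz)).sub ((hD z hz).mul (hkA_deriv z))).congr_deriv ?_
      ring
    · simpa using (tE.mul tI).sub (tD.mul tA)
  have hQ : D z / hkI z = 0 := by
    refine const_zero_of_deriv (f := fun z => D z / hkI z) ?_ ?_ hz
    · intro z hz
      refine ((hD z hz).div (hkI_deriv hz) (hkI_pos hz).ne').congr_deriv ?_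
      have h := hW z hz
      have : E z / z * hkI z - D z * (hkA z / z) = 0 := by
        have : E z / z * hkI z - D z * (hkA z / z) = (E z * hkI z - D z * hkA z) / z := by ring
        rw [this, h, zero_div]
      rw [this, zero_div]
    · have := tD.div tI one_ne_zero
      rw [zero_div] at this
      exact this
  have h0 : D z = 0 := by
    rcases div_eq_zero_iff.1 hQ with h | h
    · exact h
    · exact absurd h (hkI_pos hz).ne'
  simp only [D] at h0
  linarith

lemma besselK0_eq {x : ℝ} (hx : 0 < x) : 2 * besselK0 x = hkJ 1 (x ^ 2 / 4) := by
  have hz : 0 < x ^ 2 / 4 := by positivity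
  rw [hkJ1_formula hz]
  have h1 : besselI0 x = hkI (x ^ 2 / 4) := rfl
  have h2 : besselPsi x = hkP (x ^ 2 / 4) := by
    rw [hkP, hkS, (hkS_summable hkp_bound _).tsum_eq_zero_add]
    simp [hkp, harmonicNum, besselPsi]
  have h3 : Real.log (x ^ 2 / 4) = 2 * Real.log (x / 2) := by
    rw [show x ^ 2 / 4 = (x / 2) ^ 2 by ring, Real.log_pow]; norm_num
  rw [besselK0, h1, h2, h3]; ring

/-- **Laplace transform of the planar heat kernel.** For `a > 0` and `λ > 0`,
`∫₀^∞ e^{−λt} (2πt)⁻¹ e^{−a²/(2t)} dt = (1/π) K₀(√(2λ) a)`. -/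
theorem heat_kernel_laplace_transform (a lam : ℝ) (ha : 0 < a) (hlam : 0 < lam) :
    ∫ t in Set.Ioi (0:ℝ),
        Real.exp (-lam * t) * (1 / (2 * Real.pi * t)) * Real.exp (-a^2 / (2 * t))
      = (1 / Real.pi) * besselK0 (Real.sqrt (2 * lam) * a) := by
  have hx : 0 < Real.sqrt (2 * lam) * a := by positivity
  have h := besselK0_eq hx
  have hz : (Real.sqrt (2 * lam) * a) ^ 2 / 4 = lam * a ^ 2 / 2 := by
    rw [mul_pow, Real.sq_sqrt (by positivity)]; ring
  rw [hz] at h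
  have hK : besselK0 (Real.sqrt (2 * lam) * a) = hkJ 1 (lam * a ^ 2 / 2) / 2 := by linarith
  rw [hK]
  have hs := integral_comp_mul_left_Ioi
    (fun s => hke (lam * a ^ 2 / 2) s / s ^ 1) 0 hlam
  rw [mul_zero, smul_eq_mul] at hs
  have e : hkJ 1 (lam * a ^ 2 / 2)
      = lam * ∫ t in Ioi (0 : ℝ), hke (lam * a ^ 2 / 2) (lam * t) / (lam * t) ^ 1 := by
    rw [hs, hkJ]; field_simp
  rw [e, ← integral_const_mul, ← integral_div, ← integral_const_mul]
  refine setIntegral_congr_fun measurableSet_Ioi fun t ht => ?_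
  have ht : 0 < t := ht
  have hpi := Real.pi_pos
  have e2 : hke (lam * a ^ 2 / 2) (lam * t)
      = Real.exp (-lam * t) * Real.exp (-a ^ 2 / (2 * t)) := by
    rw [hke, ← Real.exp_add]; congr 1; field_simp; ring
  simp only [e2]
  field_simp
end
end
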